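/- (Uniform stability of the BBGKY hierarchy.) Assume the interaction kernel K satisfies (HK1)-(HK2) with constant L. Let M, N ≥ 1, let P_M^in be a symmetric Borel probability measure on (ℝ^d)^M with finite first moment and Q_N^in a symmetric Borel probability measure on (ℝ^d)^N with finite first moment, and set P_M(t) := T_t#P_M^in (M-particle flow) and Q_N(t) := T_t#Q_N^in (N-particle flow). Then: (a) for each t ∈ ℝ, Dist_{MK,1}(P_M(t), Q_N(t)) ≤ e^{2L|t|} Dist_{MK,1}(P_M^in, Q_N^in); (b) for each t ∈ ℝ, each m with M, N ≥ m ≥ 1, and each bounded Lipschitz continuous φ_m : (ℝ^d)^m → ℝ, |∫φ_m dP_{M:m}(t) − ∫φ_m dQ_{N:m}(t)| ≤ m ( e^{2L|t|} Lip(φ_m) Dist_{MK,1}(P_M^in, Q_N^in) + (m−1) ‖φ_m‖_∞ (1/M + 1/N) ). -/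

import Mathlib

open MeasureTheory Real Filter Topology
open scoped ENNReal NNReal

noncomputable section

/-- The empirical measure of an `N`-tuple of points in `ℝ^d`. -/
def empiricalMeasure {d N : ℕ} (z : Fin N → EuclideanSpace ℝ (Fin d)) :
    Measure (EuclideanSpace ℝ (Fin d)) :=
  (N : ℝ≥0∞)⁻¹ • ∑ j : Fin N, Measure.dirac (z j)

/-- The set of couplings of two Borel probability measures on two (possibly
different) measurable spaces. -/
def couplings2 {α β : Type*} [MeasurableSpace α] [MeasurableSpace β]
    (P : Measure α) (Q : Measure β) : Set (Measure (α × β)) :=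
  {ρ | ρ.map Prod.fst = P ∧ ρ.map Prod.snd = Q}

/-- The Monge-Kantorovich distance with exponent 1 (with values in `ℝ≥0∞`). -/
def distMK1 {d : ℕ} (μ ν : Measure (EuclideanSpace ℝ (Fin d))) : ℝ≥0∞ :=
  ⨅ γ ∈ couplings2 μ ν, ∫⁻ p, edist p.1 p.2 ∂γ

/-- A measure on `(ℝ^d)^N` is symmetric if it is invariant under every
permutation of the coordinates. -/
def IsSymmetricMeasure {d N : ℕ} (P : Measure (Fin N → EuclideanSpace ℝ (Fin d))) :
    Prop :=
  ∀ σ : Equiv.Perm (Fin N),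
    Measure.map (fun z (i : Fin N) => z (σ i)) P = P

/-- The `Dist_{MK,1}` distance between an `M`-particle distribution and an
`N`-particle distribution, both viewed as laws of random empirical measures. -/
def bigDistMK1 {d M N : ℕ} (P : Measure (Fin M → EuclideanSpace ℝ (Fin d)))
    (Q : Measure (Fin N → EuclideanSpace ℝ (Fin d))) : ℝ≥0∞ :=
  ⨅ ρ ∈ couplings2 P Q,
    ∫⁻ p, distMK1 (empiricalMeasure p.1) (empiricalMeasure p.2) ∂ρ

/-- The weights `w i j` form a coupling of the uniform distributions on `Fin M` and `Fin N`. -/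
structure IsWeightCoupling {M N : ℕ} (w : Fin M → Fin N → ℝ) : Prop where
  nonneg : ∀ i j, 0 ≤ w i j
  row : ∀ i, ∑ j, w i j = (M : ℝ)⁻¹
  col : ∀ j, ∑ i, w i j = (N : ℝ)⁻¹

theorem IsWeightCoupling.sum_eq_one {M N : ℕ} {w : Fin M → Fin N → ℝ}
    (hw : IsWeightCoupling w) (hM : 1 ≤ M) : ∑ i, ∑ j, w i j = 1 := by
  have : (M : ℝ) ≠ 0 := by positivity
  simp [hw.row, this]

section Gronwall

variable {E : Type*} [NormedAddCommGroup E] [NormedSpace ℝ E]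

theorem IsWeightCoupling.sum_norm_meanField_sub_le {M N : ℕ} {w : Fin M → Fin N → ℝ}
    (hw : IsWeightCoupling w) (hM : 1 ≤ M) {L : ℝ} {K : E × E → E}
    (hK : ∀ x x' y y', ‖K (x, x') - K (y, y')‖ ≤ L * (‖x - y‖ + ‖x' - y'‖))
    (x : Fin M → E) (y : Fin N → E) :
    ∑ i, ∑ j, w i j * ‖(M : ℝ)⁻¹ • ∑ k, K (x i, x k) - (N : ℝ)⁻¹ • ∑ l, K (y j, y l)‖ ≤
      2 * L * ∑ i, ∑ j, w i j * ‖x i - y j‖ := by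
  set D := ∑ i, ∑ j, w i j * ‖x i - y j‖ with hD
  have key : ∀ i j, ‖(M : ℝ)⁻¹ • ∑ k, K (x i, x k) - (N : ℝ)⁻¹ • ∑ l, K (y j, y l)‖ ≤
      L * (‖x i - y j‖ + D) := by
    intro i j
    have e : (M : ℝ)⁻¹ • ∑ k, K (x i, x k) - (N : ℝ)⁻¹ • ∑ l, K (y j, y l) =
        ∑ k, ∑ l, w k l • (K (x i, x k) - K (y j, y l)) := by
      simp only [smul_sub, Finset.sum_sub_distrib]
      congr 1
      · simp only [← Finset.sum_smul, hw.row, Finset.smul_sum]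
      · rw [Finset.sum_comm]
        simp only [← Finset.sum_smul, hw.col, Finset.smul_sum]
    rw [e]
    calc _ ≤ ∑ k, ∑ l, w k l * (L * (‖x i - y j‖ + ‖x k - y l‖)) := by
          refine (norm_sum_le _ _).trans (Finset.sum_le_sum fun k _ => ?_)
          refine (norm_sum_le _ _).trans (Finset.sum_le_sum fun l _ => ?_)
          rw [norm_smul, Real.norm_of_nonneg (hw.nonneg k l)]
          exact mul_le_mul_of_nonneg_left (hK _ _ _ _) (hw.nonneg k l)
      _ = L * ((∑ k, ∑ l, w k l) * ‖x i - y j‖ + D) := by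
          simp only [hD, Finset.mul_sum, Finset.sum_mul, ← Finset.sum_add_distrib]
          exact Finset.sum_congr rfl fun k _ => Finset.sum_congr rfl fun l _ => by ring
      _ = _ := by rw [hw.sum_eq_one hM, one_mul]
  calc _ ≤ ∑ i, ∑ j, w i j * (L * (‖x i - y j‖ + D)) :=
        Finset.sum_le_sum fun i _ => Finset.sum_le_sum fun j _ =>
          mul_le_mul_of_nonneg_left (key i j) (hw.nonneg i j)
    _ = L * (D + (∑ i, ∑ j, w i j) * D) := by
        conv_rhs => enter [2, 1]; rw [hD]
        simp only [Finset.mul_sum, Finset.sum_mul, ← Finset.sum_add_distrib]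
        exact Finset.sum_congr rfl fun k _ => Finset.sum_congr rfl fun l _ => by ring
    _ = _ := by rw [hw.sum_eq_one hM]; ring

theorem IsWeightCoupling.sum_norm_sub_le_exp_of_nonneg {M N : ℕ} {w : Fin M → Fin N → ℝ}
    (hw : IsWeightCoupling w) (hM : 1 ≤ M) {L : ℝ} {K : E × E → E}
    (hK : ∀ x x' y y', ‖K (x, x') - K (y, y')‖ ≤ L * (‖x - y‖ + ‖x' - y'‖))
    {x : ℝ → Fin M → E} {y : ℝ → Fin N → E}
    (hx : ∀ t, HasDerivAt x (fun i => (M : ℝ)⁻¹ • ∑ j, K (x t i, x t j)) t)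
    (hy : ∀ t, HasDerivAt y (fun i => (N : ℝ)⁻¹ • ∑ j, K (y t i, y t j)) t)
    {t : ℝ} (ht : 0 ≤ t) :
    ∑ i, ∑ j, w i j * ‖x t i - y t j‖ ≤
      Real.exp (2 * L * t) * ∑ i, ∑ j, w i j * ‖x 0 i - y 0 j‖ := by
  let c : (Fin M × Fin N → E) ≃L[ℝ] PiLp 1 (fun _ : Fin M × Fin N => E) :=
    (PiLp.continuousLinearEquiv 1 ℝ (fun _ : Fin M × Fin N => E)).symm
  have hnorm : ∀ (u : Fin M → E) (v : Fin N → E),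
      ‖c (fun p => w p.1 p.2 • (u p.1 - v p.2))‖ = ∑ i, ∑ j, w i j * ‖u i - v j‖ := by
    intro u v
    rw [PiLp.norm_eq_of_L1, Fintype.sum_prod_type]
    refine Finset.sum_congr rfl fun i _ => Finset.sum_congr rfl fun j _ => ?_
    change ‖w i j • (u i - v j)‖ = _
    rw [norm_smul, Real.norm_of_nonneg (hw.nonneg i j)]
  have hderiv : ∀ s, HasDerivAt (fun s => c (fun p => w p.1 p.2 • (x s p.1 - y s p.2)))
      (c (fun p => w p.1 p.2 • ((M : ℝ)⁻¹ • ∑ k, K (x s p.1, x s k) -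
        (N : ℝ)⁻¹ • ∑ l, K (y s p.2, y s l)))) s := by
    intro s
    refine c.hasFDerivAt.comp_hasDerivAt s (hasDerivAt_pi.2 fun p => ?_)
    exact ((hasDerivAt_pi.1 (hx s) p.1).sub (hasDerivAt_pi.1 (hy s) p.2)).const_smul _
  have := norm_le_gronwallBound_of_norm_deriv_right_le (a := 0) (b := t) (ε := 0) (K := 2 * L)
    (fun s _ => (hderiv s).continuousAt.continuousWithinAt)
    (fun s _ => (hderiv s).hasDerivWithinAt) le_rfl
    (fun s _ => by
      rw [add_zero, hnorm,
        hnorm (fun i => (M : ℝ)⁻¹ • ∑ k, K (x s i, x s k))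
          (fun j => (N : ℝ)⁻¹ • ∑ l, K (y s j, y s l))]
      exact hw.sum_norm_meanField_sub_le hM hK (x s) (y s)) t ⟨ht, le_rfl⟩
  rwa [hnorm, hnorm, gronwallBound_ε0, sub_zero, mul_comm] at this

theorem hasDerivAt_meanField_neg {M : ℕ} {K : E × E → E} {x : ℝ → Fin M → E}
    (hx : ∀ t, HasDerivAt x (fun i => (M : ℝ)⁻¹ • ∑ j, K (x t i, x t j)) t) (t : ℝ) :
    HasDerivAt (fun s => x (-s))
      (fun i => (M : ℝ)⁻¹ • ∑ j, (fun p => -K p) (x (-t) i, x (-t) j)) t := by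
  refine (HasDerivAt.scomp t (hx (-t)) (hasDerivAt_neg t)).congr_deriv ?_
  ext i
  simp

theorem IsWeightCoupling.sum_norm_sub_le_exp {M N : ℕ} {w : Fin M → Fin N → ℝ}
    (hw : IsWeightCoupling w) (hM : 1 ≤ M) {L : ℝ} {K : E × E → E}
    (hK : ∀ x x' y y', ‖K (x, x') - K (y, y')‖ ≤ L * (‖x - y‖ + ‖x' - y'‖))
    {x : ℝ → Fin M → E} {y : ℝ → Fin N → E}
    (hx : ∀ t, HasDerivAt x (fun i => (M : ℝ)⁻¹ • ∑ j, K (x t i, x t j)) t)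
    (hy : ∀ t, HasDerivAt y (fun i => (N : ℝ)⁻¹ • ∑ j, K (y t i, y t j)) t) (t : ℝ) :
    ∑ i, ∑ j, w i j * ‖x t i - y t j‖ ≤
      Real.exp (2 * L * |t|) * ∑ i, ∑ j, w i j * ‖x 0 i - y 0 j‖ := by
  rcases le_total 0 t with ht | ht
  · rw [abs_of_nonneg ht]
    exact hw.sum_norm_sub_le_exp_of_nonneg hM hK hx hy ht
  · rw [abs_of_nonpos ht]
    have := hw.sum_norm_sub_le_exp_of_nonneg hM (K := fun p => -K p) (L := L)
      (fun x x' y y' => by rw [← norm_neg, neg_sub_neg, neg_sub]; exact hK x x' y y')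
      (hasDerivAt_meanField_neg hx) (hasDerivAt_meanField_neg hy) (neg_nonneg.2 ht)
    simpa using this

theorem isWeightCoupling_diagonal (M : ℕ) :
    IsWeightCoupling (fun i j : Fin M => if i = j then (M : ℝ)⁻¹ else 0) where
  nonneg i j := by split_ifs <;> positivity
  row i := by simp
  col j := by simp

/-- Uniqueness of the trajectories of the particle system. -/
theorem meanField_unique {M : ℕ} {L : ℝ} {K : E × E → E}
    (hK : ∀ x x' y y', ‖K (x, x') - K (y, y')‖ ≤ L * (‖x - y‖ + ‖x' - y'‖))
    {x y : ℝ → Fin M → E}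
    (hx : ∀ t, HasDerivAt x (fun i => (M : ℝ)⁻¹ • ∑ j, K (x t i, x t j)) t)
    (hy : ∀ t, HasDerivAt y (fun i => (M : ℝ)⁻¹ • ∑ j, K (y t i, y t j)) t)
    (h0 : x 0 = y 0) (t : ℝ) : x t = y t := by
  ext i
  have hM : 1 ≤ M := i.pos
  have hM' : (0 : ℝ) < (M : ℝ)⁻¹ := by positivity
  have h := (isWeightCoupling_diagonal M).sum_norm_sub_le_exp hM hK hx hy t
  simp only [ite_mul, zero_mul, Finset.sum_ite_eq, Finset.mem_univ, if_true, h0, sub_self,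
    norm_zero, mul_zero, Finset.sum_const_zero] at h
  have h' := (Finset.sum_eq_zero_iff_of_nonneg fun i _ => by positivity).1
    (le_antisymm h (Finset.sum_nonneg fun i _ => by positivity)) i (Finset.mem_univ i)
  rw [mul_eq_zero, or_iff_right hM'.ne', norm_eq_zero, sub_eq_zero] at h'
  exact h'

theorem flow_comp_perm {M : ℕ} {L : ℝ} {K : E × E → E}
    (hK : ∀ x x' y y', ‖K (x, x') - K (y, y')‖ ≤ L * (‖x - y‖ + ‖x' - y'‖))
    {T : ℝ → (Fin M → E) → (Fin M → E)} (hT0 : ∀ Z, T 0 Z = Z)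
    (hT : ∀ Z t, HasDerivAt (fun s => T s Z)
      (fun i => (M : ℝ)⁻¹ • ∑ j, K (T t Z i, T t Z j)) t)
    (σ : Equiv.Perm (Fin M)) (Z : Fin M → E) (t : ℝ) :
    T t (fun i => Z (σ i)) = fun i => T t Z (σ i) := by
  refine meanField_unique hK (x := fun s => T s (fun i => Z (σ i)))
    (y := fun s i => T s Z (σ i)) (hT _) (fun s => hasDerivAt_pi.2 fun i => ?_) (by simp [hT0]) t
  rw [Equiv.sum_comp σ (fun j => K (T s Z (σ i), T s Z j))]
  exact hasDerivAt_pi.1 (hT Z s) (σ i)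

end Gronwall

theorem norm_sub_le_of_norm_fderiv_le {E F G : Type*} [NormedAddCommGroup E] [NormedSpace ℝ E]
    [NormedAddCommGroup F] [NormedSpace ℝ F] [NormedAddCommGroup G] [NormedSpace ℝ G] {L : ℝ}
    {K : E × F → G} (hK : Differentiable ℝ K)
    (h₁ : ∀ z z', ‖fderiv ℝ (fun w => K (w, z')) z‖ ≤ L)
    (h₂ : ∀ z z', ‖fderiv ℝ (fun w => K (z, w)) z'‖ ≤ L) (x : E) (x' : F) (y : E) (y' : F) :
    ‖K (x, x') - K (y, y')‖ ≤ L * (‖x - y‖ + ‖x' - y'‖) := by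
  have e₁ : ‖K (x, x') - K (y, x')‖ ≤ L * ‖x - y‖ :=
    convex_univ.norm_image_sub_le_of_norm_fderiv_le (𝕜 := ℝ) (f := fun w => K (w, x'))
      (fun z _ => by fun_prop) (fun z _ => h₁ z x') (Set.mem_univ _) (Set.mem_univ _)
  have e₂ : ‖K (y, x') - K (y, y')‖ ≤ L * ‖x' - y'‖ :=
    convex_univ.norm_image_sub_le_of_norm_fderiv_le (𝕜 := ℝ) (f := fun w => K (y, w))
      (fun z _ => by fun_prop) (fun z _ => h₂ y z) (Set.mem_univ _) (Set.mem_univ _)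
  calc _ ≤ ‖K (x, x') - K (y, x')‖ + ‖K (y, x') - K (y, y')‖ := norm_sub_le_norm_sub_add_norm_sub ..
    _ ≤ _ := by linarith

section EmpiricalCoupling

variable {d : ℕ}

theorem lintegral_empiricalMeasure {N : ℕ} (Z : Fin N → EuclideanSpace ℝ (Fin d))
    (f : EuclideanSpace ℝ (Fin d) → ℝ≥0∞) :
    ∫⁻ x, f x ∂(empiricalMeasure Z) = (N : ℝ≥0∞)⁻¹ * ∑ j, f (Z j) := by
  simp [empiricalMeasure, lintegral_smul_measure]

/-- A point `x` in the range of `Z` is split uniformly among the indices `j` with `Z j = x`;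
this is the share received by the index `i`. -/
def indexShare {N : ℕ} (Z : Fin N → EuclideanSpace ℝ (Fin d)) (i : Fin N)
    (x : EuclideanSpace ℝ (Fin d)) : ℝ≥0∞ :=
  Set.indicator {Z i} (fun _ => (Finset.card {k | Z k = Z i} : ℝ≥0∞)⁻¹) x

theorem measurable_indexShare {N : ℕ} (Z : Fin N → EuclideanSpace ℝ (Fin d)) (i : Fin N) :
    Measurable (indexShare Z i) :=
  measurable_const.indicator (measurableSet_singleton _)

theorem card_fiber_mul_inv {N : ℕ} (Z : Fin N → EuclideanSpace ℝ (Fin d)) (i : Fin N) :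
    (Finset.card {k | Z k = Z i} : ℝ≥0∞) * (Finset.card {k | Z k = Z i} : ℝ≥0∞)⁻¹ = 1 := by
  refine ENNReal.mul_inv_cancel ?_ (ENNReal.natCast_ne_top _)
  rw [Nat.cast_ne_zero, Finset.card_ne_zero]
  exact ⟨i, by simp⟩

theorem sum_indexShare_apply {N : ℕ} (Z : Fin N → EuclideanSpace ℝ (Fin d)) (k : Fin N) :
    ∑ i, indexShare Z i (Z k) = 1 := by
  rw [← card_fiber_mul_inv Z k, ← nsmul_eq_mul, ← Finset.sum_const, Finset.sum_filter]
  refine Finset.sum_congr rfl fun i _ => ?_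
  by_cases h : Z i = Z k
  · simp [indexShare, h]
  · simp [indexShare, h, Ne.symm h]

theorem lintegral_indexShare {N : ℕ} (Z : Fin N → EuclideanSpace ℝ (Fin d)) (i : Fin N) :
    ∫⁻ x, indexShare Z i x ∂(empiricalMeasure Z) = (N : ℝ≥0∞)⁻¹ := by
  rw [lintegral_empiricalMeasure]
  conv_rhs => rw [← mul_one (N : ℝ≥0∞)⁻¹, ← card_fiber_mul_inv Z i, ← nsmul_eq_mul,
    ← Finset.sum_const, Finset.sum_filter]
  simp [indexShare, Set.indicator_apply]

theorem ae_sum_indexShare {α : Type*} [MeasurableSpace α] {γ : Measure α} {N : ℕ}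
    {Z : Fin N → EuclideanSpace ℝ (Fin d)} {f : α → EuclideanSpace ℝ (Fin d)}
    (hf : Measurable f) (hγ : γ.map f = empiricalMeasure Z) :
    ∀ᵐ p ∂γ, ∑ i, indexShare Z i (f p) = 1 := by
  refine ae_of_ae_map (p := fun x => ∑ i, indexShare Z i x = 1) hf.aemeasurable ?_
  have hmeas : MeasurableSet {x | ¬ ∑ i, indexShare Z i x = 1} :=
    (measurableSet_eq_fun (Finset.measurable_sum _ fun i _ => measurable_indexShare Z i)
      measurable_const).compl
  rw [hγ, ae_iff, empiricalMeasure]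
  simp [Measure.dirac_apply' _ hmeas, sum_indexShare_apply]

theorem exists_isWeightCoupling_of_mem_couplings2 {M N : ℕ} (hM : 1 ≤ M)
    {X : Fin M → EuclideanSpace ℝ (Fin d)} {Y : Fin N → EuclideanSpace ℝ (Fin d)}
    {γ : Measure (EuclideanSpace ℝ (Fin d) × EuclideanSpace ℝ (Fin d))}
    (hγ : γ ∈ couplings2 (empiricalMeasure X) (empiricalMeasure Y)) :
    ∃ w : Fin M → Fin N → ℝ, IsWeightCoupling w ∧
      ENNReal.ofReal (∑ i, ∑ j, w i j * ‖X i - Y j‖) = ∫⁻ p, edist p.1 p.2 ∂γ := by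
  obtain ⟨hX, hY⟩ := hγ
  have mX : ∀ i, Measurable fun p : EuclideanSpace ℝ (Fin d) × EuclideanSpace ℝ (Fin d) =>
      indexShare X i p.1 := fun i => (measurable_indexShare X i).comp measurable_fst
  have mY : ∀ j, Measurable fun p : EuclideanSpace ℝ (Fin d) × EuclideanSpace ℝ (Fin d) =>
      indexShare Y j p.2 := fun j => (measurable_indexShare Y j).comp measurable_snd
  have mXY : ∀ i j, Measurable fun p : EuclideanSpace ℝ (Fin d) × EuclideanSpace ℝ (Fin d) =>
      indexShare X i p.1 * indexShare Y j p.2 := fun i j => (mX i).mul (mY j)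
  have aeX := ae_sum_indexShare measurable_fst hX
  have aeY := ae_sum_indexShare measurable_snd hY
  set W : Fin M → Fin N → ℝ≥0∞ := fun i j => ∫⁻ p, indexShare X i p.1 * indexShare Y j p.2 ∂γ
    with hW
  have row : ∀ i, ∑ j, W i j = (M : ℝ≥0∞)⁻¹ := fun i => by
    rw [hW, ← lintegral_finsetSum _ fun j _ => mXY i j, ← lintegral_indexShare X i, ← hX,
      lintegral_map (measurable_indexShare X i) measurable_fst]
    refine lintegral_congr_ae ?_
    filter_upwards [aeY] with p hp
    rw [← Finset.mul_sum, hp, mul_one]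
  have col : ∀ j, ∑ i, W i j = (N : ℝ≥0∞)⁻¹ := fun j => by
    rw [hW, ← lintegral_finsetSum _ fun i _ => mXY i j, ← lintegral_indexShare Y j, ← hY,
      lintegral_map (measurable_indexShare Y j) measurable_snd]
    refine lintegral_congr_ae ?_
    filter_upwards [aeX] with p hp
    rw [← Finset.sum_mul, hp, one_mul]
  have fin : ∀ i j, W i j ≠ ⊤ := fun i j =>
    ((Finset.single_le_sum (f := W i) (fun _ _ => zero_le) (Finset.mem_univ j)).trans_lt
      (by rw [row i]; exact ENNReal.inv_lt_top.2 (by exact_mod_cast hM))).ne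
  refine ⟨fun i j => (W i j).toReal, ⟨fun _ _ => ENNReal.toReal_nonneg, fun i => ?_, fun j => ?_⟩,
    ?_⟩
  · rw [← ENNReal.toReal_sum fun j _ => fin i j, row]
    simp
  · rw [← ENNReal.toReal_sum fun i _ => fin i j, col]
    simp
  · have hterm : ∀ i j, ENNReal.ofReal ((W i j).toReal * ‖X i - Y j‖) =
        ∫⁻ p, indexShare X i p.1 * indexShare Y j p.2 * edist p.1 p.2 ∂γ := fun i j => by
      rw [ENNReal.ofReal_mul ENNReal.toReal_nonneg, ENNReal.ofReal_toReal (fin i j),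
        ← dist_eq_norm, ← edist_dist, hW, ← lintegral_mul_const _ (mXY i j)]
      refine lintegral_congr fun p => ?_
      by_cases h₁ : p.1 = X i
      · by_cases h₂ : p.2 = Y j
        · rw [h₁, h₂]
        · simp [indexShare, h₂]
      · simp [indexShare, h₁]
    rw [ENNReal.ofReal_sum_of_nonneg fun i _ => Finset.sum_nonneg fun j _ => by positivity]
    simp_rw [ENNReal.ofReal_sum_of_nonneg fun j _ =>
      mul_nonneg ENNReal.toReal_nonneg (norm_nonneg (X _ - Y j)), hterm]
    have mm : ∀ i j, Measurable
        fun p : EuclideanSpace ℝ (Fin d) × EuclideanSpace ℝ (Fin d) =>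
          indexShare X i p.1 * indexShare Y j p.2 * edist p.1 p.2 := fun i j =>
      (mXY i j).mul measurable_edist
    simp_rw [← lintegral_finsetSum _ fun j _ => mm _ j]
    rw [← lintegral_finsetSum _ fun i _ => Finset.measurable_sum _ fun j _ => mm i j]
    refine lintegral_congr_ae ?_
    filter_upwards [aeX, aeY] with p h₁ h₂
    simp_rw [← Finset.sum_mul, ← Finset.mul_sum, h₂, mul_one, h₁, one_mul]

theorem IsWeightCoupling.distMK1_le {M N : ℕ} {w : Fin M → Fin N → ℝ} (hw : IsWeightCoupling w)
    (hM : 1 ≤ M) (hN : 1 ≤ N)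
    (X : Fin M → EuclideanSpace ℝ (Fin d)) (Y : Fin N → EuclideanSpace ℝ (Fin d)) :
    distMK1 (empiricalMeasure X) (empiricalMeasure Y) ≤
      ENNReal.ofReal (∑ i, ∑ j, w i j * ‖X i - Y j‖) := by
  have inv_eq : ∀ n : ℕ, 1 ≤ n → ENNReal.ofReal ((n : ℝ)⁻¹) = (n : ℝ≥0∞)⁻¹ := fun n hn => by
    rw [ENNReal.ofReal_inv_of_pos (by positivity), ENNReal.ofReal_natCast]
  have row : ∀ i, ∑ j, ENNReal.ofReal (w i j) = (M : ℝ≥0∞)⁻¹ := fun i => by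
    rw [← ENNReal.ofReal_sum_of_nonneg fun j _ => hw.nonneg i j, hw.row, inv_eq M hM]
  have col : ∀ j, ∑ i, ENNReal.ofReal (w i j) = (N : ℝ≥0∞)⁻¹ := fun j => by
    rw [← ENNReal.ofReal_sum_of_nonneg fun i _ => hw.nonneg i j, hw.col, inv_eq N hN]
  let γ : Measure (EuclideanSpace ℝ (Fin d) × EuclideanSpace ℝ (Fin d)) :=
    ∑ i, ∑ j, ENNReal.ofReal (w i j) • Measure.dirac (X i, Y j)
  have hγ : ∀ f : EuclideanSpace ℝ (Fin d) × EuclideanSpace ℝ (Fin d) → ℝ≥0∞,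
      ∫⁻ p, f p ∂γ = ∑ i, ∑ j, ENNReal.ofReal (w i j) * f (X i, Y j) := fun f => by
    simp [γ, lintegral_smul_measure]
  have hmem : γ ∈ couplings2 (empiricalMeasure X) (empiricalMeasure Y) := by
    constructor <;> refine Measure.ext_of_lintegral _ fun f hf => ?_
    · rw [lintegral_map hf measurable_fst, hγ, lintegral_empiricalMeasure, Finset.mul_sum]
      simp_rw [← Finset.sum_mul, row]
    · rw [lintegral_map hf measurable_snd, hγ, lintegral_empiricalMeasure, Finset.mul_sum,
        Finset.sum_comm]
      simp_rw [← Finset.sum_mul, col]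
  refine (iInf₂_le γ hmem).trans_eq ?_
  rw [hγ, ENNReal.ofReal_sum_of_nonneg fun i _ => Finset.sum_nonneg fun j _ =>
    mul_nonneg (hw.nonneg i j) (norm_nonneg _)]
  refine Finset.sum_congr rfl fun i _ => ?_
  rw [ENNReal.ofReal_sum_of_nonneg fun j _ => mul_nonneg (hw.nonneg i j) (norm_nonneg _)]
  refine Finset.sum_congr rfl fun j _ => ?_
  rw [ENNReal.ofReal_mul (hw.nonneg i j), ← dist_eq_norm, ← edist_dist]

theorem distMK1_flow_le {M N : ℕ} (hM : 1 ≤ M) (hN : 1 ≤ N) {L : ℝ}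
    {K : EuclideanSpace ℝ (Fin d) × EuclideanSpace ℝ (Fin d) → EuclideanSpace ℝ (Fin d)}
    (hK : ∀ x x' y y', ‖K (x, x') - K (y, y')‖ ≤ L * (‖x - y‖ + ‖x' - y'‖))
    {x : ℝ → Fin M → EuclideanSpace ℝ (Fin d)} {y : ℝ → Fin N → EuclideanSpace ℝ (Fin d)}
    (hx : ∀ t, HasDerivAt x (fun i => (M : ℝ)⁻¹ • ∑ j, K (x t i, x t j)) t)
    (hy : ∀ t, HasDerivAt y (fun i => (N : ℝ)⁻¹ • ∑ j, K (y t i, y t j)) t) (t : ℝ) :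
    distMK1 (empiricalMeasure (x t)) (empiricalMeasure (y t)) ≤
      ENNReal.ofReal (Real.exp (2 * L * |t|)) *
        distMK1 (empiricalMeasure (x 0)) (empiricalMeasure (y 0)) := by
  conv_rhs => rw [distMK1]
  rw [ENNReal.mul_iInf_of_ne (by simp [Real.exp_pos]) ENNReal.ofReal_ne_top]
  refine le_iInf fun γ => ?_
  rw [ENNReal.mul_iInf_of_ne (by simp [Real.exp_pos]) ENNReal.ofReal_ne_top]
  refine le_iInf fun hγ => ?_
  obtain ⟨w, hw, hcost⟩ := exists_isWeightCoupling_of_mem_couplings2 hM hγ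
  rw [← hcost, ← ENNReal.ofReal_mul (Real.exp_pos _).le]
  exact (hw.distMK1_le hM hN _ _).trans
    (ENNReal.ofReal_le_ofReal (hw.sum_norm_sub_le_exp hM hK hx hy t))

theorem map_prodMap_mem_couplings2 {α β α' β' : Type*} [MeasurableSpace α] [MeasurableSpace β]
    [MeasurableSpace α'] [MeasurableSpace β'] {P : Measure α} {Q : Measure β}
    {ρ : Measure (α × β)} (hρ : ρ ∈ couplings2 P Q) {f : α → α'} {g : β → β'}
    (hf : Measurable f) (hg : Measurable g) :
    ρ.map (Prod.map f g) ∈ couplings2 (P.map f) (Q.map g) := by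
  constructor
  · rw [Measure.map_map measurable_fst (hf.prodMap hg), ← hρ.1,
      Measure.map_map hf measurable_fst]
    rfl
  · rw [Measure.map_map measurable_snd (hf.prodMap hg), ← hρ.2,
      Measure.map_map hg measurable_snd]
    rfl

theorem bigDistMK1_map_le {M N : ℕ} {P : Measure (Fin M → EuclideanSpace ℝ (Fin d))}
    {Q : Measure (Fin N → EuclideanSpace ℝ (Fin d))}
    {S : (Fin M → EuclideanSpace ℝ (Fin d)) → (Fin M → EuclideanSpace ℝ (Fin d))}
    {T : (Fin N → EuclideanSpace ℝ (Fin d)) → (Fin N → EuclideanSpace ℝ (Fin d))}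
    (hS : Measurable S) (hT : Measurable T) {c : ℝ≥0∞} (hc₀ : c ≠ 0) (hc : c ≠ ⊤)
    (h : ∀ X Y, distMK1 (empiricalMeasure (S X)) (empiricalMeasure (T Y)) ≤
      c * distMK1 (empiricalMeasure X) (empiricalMeasure Y)) :
    bigDistMK1 (P.map S) (Q.map T) ≤ c * bigDistMK1 P Q := by
  conv_rhs => rw [bigDistMK1]
  rw [ENNReal.mul_iInf_of_ne hc₀ hc]
  refine le_iInf fun ρ => ?_
  rw [ENNReal.mul_iInf_of_ne hc₀ hc]
  refine le_iInf fun hρ => (iInf₂_le _ (map_prodMap_mem_couplings2 hρ hS hT)).trans ?_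
  refine (lintegral_map_le _ _).trans ?_
  rw [← lintegral_const_mul' _ _ hc]
  exact lintegral_mono fun p => h p.1 p.2

end EmpiricalCoupling

section TensorAverage

variable {d m : ℕ}

/-- The integral of `φ` against the `m`-fold tensor power of the empirical measure of `X`. -/
def tensorAverage {E : Type*} {M : ℕ} (φ : (Fin m → E) → ℝ) (X : Fin M → E) : ℝ :=
  ((M : ℝ) ^ m)⁻¹ * ∑ f : Fin m → Fin M, φ (fun k => X (f k))

theorem sum_sum_prod_eq_prod_sum_sum {ι κ κ' R : Type*} [CommSemiring R] [Fintype ι]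
    [DecidableEq ι] [Fintype κ] [Fintype κ'] (v : ι → κ → κ' → R) :
    ∑ f : ι → κ, ∑ g : ι → κ', ∏ k, v k (f k) (g k) = ∏ k, ∑ i, ∑ j, v k i j := by
  simp only [Finset.prod_univ_sum, Fintype.piFinset_univ]

theorem IsWeightCoupling.sum_prod_mul_apply {M N : ℕ} {w : Fin M → Fin N → ℝ}
    (hw : IsWeightCoupling w) (hM : 1 ≤ M) (c : Fin M → Fin N → ℝ) (k₀ : Fin m) :
    ∑ f : Fin m → Fin M, ∑ g : Fin m → Fin N, (∏ k, w (f k) (g k)) * c (f k₀) (g k₀) =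
      ∑ i, ∑ j, w i j * c i j := by
  have h := sum_sum_prod_eq_prod_sum_sum
    (fun (k : Fin m) i j => w i j * if k = k₀ then c i j else 1)
  simp only [Finset.prod_mul_distrib, Finset.prod_ite_eq', Finset.mem_univ, if_true] at h
  rw [h, Finset.prod_eq_single k₀]
  · simp
  · intro k _ hk
    simp [hk, hw.sum_eq_one hM]
  · simp

theorem IsWeightCoupling.abs_tensorAverage_sub_le {E : Type*} [SeminormedAddCommGroup E]
    {M N : ℕ} {w : Fin M → Fin N → ℝ}
    (hw : IsWeightCoupling w) (hM : 1 ≤ M) {φ : (Fin m → E) → ℝ} {Lφ : ℝ≥0}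
    (hφ : LipschitzWith Lφ φ) (X : Fin M → E) (Y : Fin N → E) :
    |tensorAverage φ X - tensorAverage φ Y| ≤
      m * Lφ * ∑ i, ∑ j, w i j * ‖X i - Y j‖ := by
  have hX : tensorAverage φ X = ∑ f : Fin m → Fin M, ∑ g : Fin m → Fin N,
      (∏ k, w (f k) (g k)) * φ (fun k => X (f k)) := by
    simp_rw [← Finset.sum_mul]
    have : ∀ f : Fin m → Fin M, ∑ g : Fin m → Fin N, ∏ k, w (f k) (g k) = ((M : ℝ) ^ m)⁻¹ :=
      fun f => by
        have := Finset.prod_univ_sum (fun _ : Fin m => (Finset.univ : Finset (Fin N)))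
          (fun k j => w (f k) j)
        rw [Fintype.piFinset_univ] at this
        simp [← this, hw.row]
    simp_rw [this, ← Finset.mul_sum]
    rfl
  have hY : tensorAverage φ Y = ∑ f : Fin m → Fin M, ∑ g : Fin m → Fin N,
      (∏ k, w (f k) (g k)) * φ (fun k => Y (g k)) := by
    rw [Finset.sum_comm]
    simp_rw [← Finset.sum_mul]
    have : ∀ g : Fin m → Fin N, ∑ f : Fin m → Fin M, ∏ k, w (f k) (g k) = ((N : ℝ) ^ m)⁻¹ :=
      fun g => by
        have := Finset.prod_univ_sum (fun _ : Fin m => (Finset.univ : Finset (Fin M)))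
          (fun k i => w i (g k))
        rw [Fintype.piFinset_univ] at this
        simp [← this, hw.col]
    simp_rw [this, ← Finset.mul_sum]
    rfl
  have hprod : ∀ (f : Fin m → Fin M) (g : Fin m → Fin N), 0 ≤ ∏ k, w (f k) (g k) := fun f g =>
    Finset.prod_nonneg fun k _ => hw.nonneg _ _
  have hlip : ∀ (f : Fin m → Fin M) (g : Fin m → Fin N),
      |φ (fun k => X (f k)) - φ (fun k => Y (g k))| ≤ Lφ * ∑ k, ‖X (f k) - Y (g k)‖ := by
    intro f g
    refine (hφ.dist_le_mul _ _).trans (mul_le_mul_of_nonneg_left ?_ Lφ.2)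
    rw [dist_eq_norm]
    refine (pi_norm_le_iff_of_nonneg (Finset.sum_nonneg fun k _ => norm_nonneg _)).2 fun k => ?_
    exact Finset.single_le_sum (f := fun k => ‖X (f k) - Y (g k)‖) (fun k _ => norm_nonneg _)
      (Finset.mem_univ k)
  rw [hX, hY]
  simp_rw [← Finset.sum_sub_distrib, ← mul_sub]
  calc _ ≤ ∑ f : Fin m → Fin M, ∑ g : Fin m → Fin N,
        (∏ k, w (f k) (g k)) * (Lφ * ∑ k, ‖X (f k) - Y (g k)‖) := by
        refine (Finset.abs_sum_le_sum_abs _ _).trans (Finset.sum_le_sum fun f _ => ?_)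
        refine (Finset.abs_sum_le_sum_abs _ _).trans (Finset.sum_le_sum fun g _ => ?_)
        rw [abs_mul, abs_of_nonneg (hprod f g)]
        exact mul_le_mul_of_nonneg_left (hlip f g) (hprod f g)
    _ = Lφ * ∑ k₀ : Fin m, ∑ f : Fin m → Fin M, ∑ g : Fin m → Fin N,
        (∏ k, w (f k) (g k)) * ‖X (f k₀) - Y (g k₀)‖ := by
        conv_rhs => rw [Finset.sum_comm, Finset.mul_sum]
        refine Finset.sum_congr rfl fun f _ => ?_
        rw [Finset.sum_comm, Finset.mul_sum]
        refine Finset.sum_congr rfl fun g _ => ?_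
        rw [← Finset.mul_sum]
        ring
    _ = _ := by
        simp_rw [hw.sum_prod_mul_apply hM (fun i j => ‖X i - Y j‖)]
        simp
        ring

theorem two_mul_pow_sub_descFactorial_le (M m : ℕ) :
    2 * M * ((M : ℝ) ^ m - M.descFactorial m) ≤ m * (m - 1) * (M : ℝ) ^ m := by
  induction m with
  | zero => simp
  | succ m ih =>
    have h₁ : (M.descFactorial m : ℝ) ≤ (M : ℝ) ^ m := by
      exact_mod_cast Nat.descFactorial_le_pow M m
    have h₂ : (M : ℝ) - m ≤ ((M - m : ℕ) : ℝ) := by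
      rw [sub_le_iff_le_add]
      exact_mod_cast Nat.sub_le_iff_le_add.1 le_rfl
    have h₃ : ((M : ℝ) - m) * M.descFactorial m ≤ ((M - m : ℕ) : ℝ) * M.descFactorial m := by
      gcongr
    rw [Nat.descFactorial_succ]
    push_cast
    calc _ ≤ 2 * M * ((M : ℝ) ^ (m + 1) - ((M : ℝ) - m) * M.descFactorial m) := by gcongr
      _ = M * (2 * M * ((M : ℝ) ^ m - M.descFactorial m)) + 2 * M * m * M.descFactorial m := by
        ring
      _ ≤ M * (m * (m - 1) * (M : ℝ) ^ m) + 2 * M * m * (M : ℝ) ^ m := by gcongr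
      _ = _ := by ring

theorem card_filter_not_injective (M m : ℕ) :
    ((Finset.card {f : Fin m → Fin M | ¬ Function.Injective f} : ℕ) : ℝ) =
      (M : ℝ) ^ m - M.descFactorial m := by
  have h₁ : Finset.card {f : Fin m → Fin M | Function.Injective f} = M.descFactorial m := by
    rw [← Fintype.card_subtype, Fintype.card_congr (Equiv.subtypeInjectiveEquivEmbedding _ _)]
    simp [Fintype.card_embedding_eq]
  have h₂ := Finset.card_filter_add_card_filter_not (s := (Finset.univ : Finset (Fin m → Fin M)))
    Function.Injective
  rw [h₁] at h₂
  simp only [Finset.card_univ, Fintype.card_pi, Fintype.card_fin, Finset.prod_const] at h₂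
  rw [eq_sub_iff_add_eq, add_comm]
  exact_mod_cast h₂

theorem IsSymmetricMeasure.integral_comp_injective {M : ℕ}
    {P : Measure (Fin M → EuclideanSpace ℝ (Fin d))} (hP : IsSymmetricMeasure P)
    {φ : (Fin m → EuclideanSpace ℝ (Fin d)) → ℝ} (hφ : Continuous φ) {f g : Fin m → Fin M}
    (hf : Function.Injective f) (hg : Function.Injective g) :
    ∫ Z, φ (fun k => Z (f k)) ∂P = ∫ Z, φ (fun k => Z (g k)) ∂P := by
  have := Equiv.Perm.isMultiplyPretransitive (Fin M) m
  obtain ⟨σ, hσ⟩ := MulAction.exists_smul_eq (Equiv.Perm (Fin M))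
    (⟨f, hf⟩ : Fin m ↪ Fin M) ⟨g, hg⟩
  have hσ' : ∀ k, σ (f k) = g k := fun k => DFunLike.congr_fun hσ k
  conv_lhs => rw [← hP σ]
  rw [integral_map (Measurable.aemeasurable (by fun_prop)) (Continuous.aestronglyMeasurable (by fun_prop))]
  simp only [hσ']

theorem integrable_comp_of_bounded {M : ℕ} {P : Measure (Fin M → EuclideanSpace ℝ (Fin d))}
    [IsFiniteMeasure P] {φ : (Fin m → EuclideanSpace ℝ (Fin d)) → ℝ} (hφ : Continuous φ)
    {C : ℝ} (hC : ∀ w, |φ w| ≤ C) (f : Fin m → Fin M) :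
    Integrable (fun Z => φ (fun k => Z (f k))) P :=
  Integrable.of_bound (Continuous.aestronglyMeasurable (by fun_prop)) C
    (ae_of_all _ fun _ => hC _)

theorem integrable_tensorAverage {M : ℕ} {P : Measure (Fin M → EuclideanSpace ℝ (Fin d))}
    [IsFiniteMeasure P] {φ : (Fin m → EuclideanSpace ℝ (Fin d)) → ℝ} (hφ : Continuous φ)
    {C : ℝ} (hC : ∀ w, |φ w| ≤ C) : Integrable (tensorAverage φ) P :=
  (integrable_finsetSum _ fun f _ => integrable_comp_of_bounded hφ hC f).const_mul _

/-- Comparison of the `m`-particle marginal with the mean of the tensor powers of the empirical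
measure. -/
theorem IsSymmetricMeasure.abs_integral_sub_tensorAverage_le {M : ℕ} (hM : 1 ≤ M)
    {P : Measure (Fin M → EuclideanSpace ℝ (Fin d))} [IsProbabilityMeasure P]
    (hP : IsSymmetricMeasure P)
    {φ : (Fin m → EuclideanSpace ℝ (Fin d)) → ℝ} (hφ : Continuous φ)
    {C : ℝ} (hC : ∀ w, |φ w| ≤ C) {g : Fin m → Fin M} (hg : Function.Injective g) :
    |∫ Z, φ (fun k => Z (g k)) ∂P - ∫ Z, tensorAverage φ Z ∂P| ≤
      m * ((m - 1) * C * (M : ℝ)⁻¹) := by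
  have hC0 : 0 ≤ C := (abs_nonneg _).trans (hC 0)
  have hM0 : (0 : ℝ) < M := by positivity
  have hbound : ∀ f : Fin m → Fin M, |∫ Z, φ (fun k => Z (f k)) ∂P| ≤ C := fun f => by
    simpa using norm_integral_le_of_norm_le_const (μ := P) (f := fun Z => φ (fun k => Z (f k)))
      (ae_of_all _ fun Z => hC _)
  have hterm : ∀ f : Fin m → Fin M,
      |∫ Z, φ (fun k => Z (g k)) ∂P - ∫ Z, φ (fun k => Z (f k)) ∂P| ≤
        if ¬ Function.Injective f then 2 * C else 0 := fun f => by
    by_cases h : Function.Injective f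
    · rw [hP.integral_comp_injective hφ hg h]
      simp [h]
    · rw [if_pos h]
      refine (abs_sub _ _).trans ?_
      linarith [hbound f, hbound g]
  have havg : ∫ Z, tensorAverage φ Z ∂P =
      ((M : ℝ) ^ m)⁻¹ * ∑ f : Fin m → Fin M, ∫ Z, φ (fun k => Z (f k)) ∂P := by
    simp only [tensorAverage]
    rw [integral_const_mul, integral_finsetSum _ fun f _ => integrable_comp_of_bounded hφ hC f]
  have hconst : ∫ Z, φ (fun k => Z (g k)) ∂P =
      ((M : ℝ) ^ m)⁻¹ * ∑ f : Fin m → Fin M, ∫ Z, φ (fun k => Z (g k)) ∂P := by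
    simp [hM0.ne']
  rw [havg, hconst, ← mul_sub, ← Finset.sum_sub_distrib, abs_mul, abs_of_pos (by positivity)]
  calc _ ≤ ((M : ℝ) ^ m)⁻¹ * ∑ f : Fin m → Fin M, if ¬ Function.Injective f then 2 * C else 0 := by
        gcongr
        exact (Finset.abs_sum_le_sum_abs _ _).trans (Finset.sum_le_sum fun f _ => hterm f)
    _ = ((M : ℝ) ^ m)⁻¹ * (2 * M * ((M : ℝ) ^ m - M.descFactorial m)) * (C * (M : ℝ)⁻¹) := by
        rw [← Finset.sum_filter, Finset.sum_const, nsmul_eq_mul, card_filter_not_injective]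
        field_simp
    _ ≤ ((M : ℝ) ^ m)⁻¹ * (m * (m - 1) * (M : ℝ) ^ m) * (C * (M : ℝ)⁻¹) := by
        gcongr ?_ * ?_ * _
        exact two_mul_pow_sub_descFactorial_le M m
    _ = _ := by field_simp

theorem le_mul_biInf_of_nonempty {ι : Type*} {S : Set ι} (hS : S.Nonempty) {f : ι → ℝ≥0∞}
    {a c : ℝ≥0∞} (hc : c ≠ ⊤) (h : ∀ i ∈ S, a ≤ c * f i) : a ≤ c * ⨅ i ∈ S, f i := by
  have := hS.to_subtype
  rw [iInf_subtype', ENNReal.mul_iInf' (fun h => absurd h hc) fun _ => inferInstance]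
  exact le_iInf fun i => h i i.2

theorem couplings2_nonempty {α β : Type*} [MeasurableSpace α] [MeasurableSpace β]
    (P : Measure α) (Q : Measure β) [IsProbabilityMeasure P] [IsProbabilityMeasure Q] :
    (couplings2 P Q).Nonempty :=
  ⟨P.prod Q, by simp [couplings2]⟩

theorem isProbabilityMeasure_empiricalMeasure {N : ℕ} (hN : 1 ≤ N)
    (Z : Fin N → EuclideanSpace ℝ (Fin d)) : IsProbabilityMeasure (empiricalMeasure Z) := by
  constructor
  rw [← lintegral_one, lintegral_empiricalMeasure]
  simpa using ENNReal.inv_mul_cancel (Nat.cast_ne_zero.2 (by lia)) (ENNReal.natCast_ne_top N)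

theorem enorm_tensorAverage_sub_le {M N : ℕ} (hM : 1 ≤ M) (hN : 1 ≤ N)
    {φ : (Fin m → EuclideanSpace ℝ (Fin d)) → ℝ} {Lφ : ℝ≥0} (hφ : LipschitzWith Lφ φ)
    (X : Fin M → EuclideanSpace ℝ (Fin d)) (Y : Fin N → EuclideanSpace ℝ (Fin d)) :
    ‖tensorAverage φ X - tensorAverage φ Y‖ₑ ≤
      (m * Lφ : ℝ≥0∞) * distMK1 (empiricalMeasure X) (empiricalMeasure Y) := by
  have := isProbabilityMeasure_empiricalMeasure hM X
  have := isProbabilityMeasure_empiricalMeasure hN Y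
  refine le_mul_biInf_of_nonempty (couplings2_nonempty _ _)
    (ENNReal.mul_ne_top (ENNReal.natCast_ne_top m) ENNReal.coe_ne_top) fun γ hγ => ?_
  obtain ⟨w, hw, hcost⟩ := exists_isWeightCoupling_of_mem_couplings2 hM hγ
  rw [Real.enorm_eq_ofReal_abs, ← hcost, ← ENNReal.ofReal_natCast m,
    ← ENNReal.ofReal_coe_nnreal (p := Lφ), ← ENNReal.ofReal_mul (by positivity),
    ← ENNReal.ofReal_mul (by positivity)]
  exact ENNReal.ofReal_le_ofReal (hw.abs_tensorAverage_sub_le hM hφ X Y)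

theorem enorm_integral_tensorAverage_sub_le {M N : ℕ} (hM : 1 ≤ M) (hN : 1 ≤ N)
    {P : Measure (Fin M → EuclideanSpace ℝ (Fin d))} [IsProbabilityMeasure P]
    {Q : Measure (Fin N → EuclideanSpace ℝ (Fin d))} [IsProbabilityMeasure Q]
    {φ : (Fin m → EuclideanSpace ℝ (Fin d)) → ℝ} {Lφ : ℝ≥0} (hφ : LipschitzWith Lφ φ)
    {C : ℝ} (hC : ∀ w, |φ w| ≤ C) :
    ‖∫ X, tensorAverage φ X ∂P - ∫ Y, tensorAverage φ Y ∂Q‖ₑ ≤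
      (m * Lφ : ℝ≥0∞) * bigDistMK1 P Q := by
  have hc : (m * Lφ : ℝ≥0∞) ≠ ⊤ :=
    ENNReal.mul_ne_top (ENNReal.natCast_ne_top m) ENNReal.coe_ne_top
  refine le_mul_biInf_of_nonempty (couplings2_nonempty _ _) hc fun ρ hρ => ?_
  have iP : Integrable (tensorAverage φ) (ρ.map Prod.fst) := by
    rw [hρ.1]
    exact integrable_tensorAverage hφ.continuous hC
  have iQ : Integrable (tensorAverage φ) (ρ.map Prod.snd) := by
    rw [hρ.2]
    exact integrable_tensorAverage hφ.continuous hC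
  have eP : ∫ X, tensorAverage φ X ∂P = ∫ p, tensorAverage φ p.1 ∂ρ := by
    rw [← integral_map measurable_fst.aemeasurable iP.aestronglyMeasurable, hρ.1]
  have eQ : ∫ Y, tensorAverage φ Y ∂Q = ∫ p, tensorAverage φ p.2 ∂ρ := by
    rw [← integral_map measurable_snd.aemeasurable iQ.aestronglyMeasurable, hρ.2]
  have iP' : Integrable (fun p => tensorAverage φ p.1) ρ := iP.comp_measurable measurable_fst
  have iQ' : Integrable (fun p => tensorAverage φ p.2) ρ := iQ.comp_measurable measurable_snd
  rw [eP, eQ, ← integral_sub iP' iQ']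
  calc _ ≤ ∫⁻ p, ‖tensorAverage φ p.1 - tensorAverage φ p.2‖ₑ ∂ρ :=
        enorm_integral_le_lintegral_enorm _
    _ ≤ ∫⁻ p, (m * Lφ : ℝ≥0∞) * distMK1 (empiricalMeasure p.1) (empiricalMeasure p.2) ∂ρ :=
        lintegral_mono fun p => enorm_tensorAverage_sub_le hM hN hφ p.1 p.2
    _ = _ := lintegral_const_mul' _ _ hc

/-- Comparison of the `m`-particle marginals of two symmetric laws. -/
theorem ofReal_abs_integral_marginal_sub_le {M N : ℕ} (hm : 1 ≤ m) (hM : m ≤ M) (hN : m ≤ N)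
    {P : Measure (Fin M → EuclideanSpace ℝ (Fin d))} [IsProbabilityMeasure P]
    {Q : Measure (Fin N → EuclideanSpace ℝ (Fin d))} [IsProbabilityMeasure Q]
    (hP : IsSymmetricMeasure P) (hQ : IsSymmetricMeasure Q)
    {φ : (Fin m → EuclideanSpace ℝ (Fin d)) → ℝ} {Lφ : ℝ≥0} (hφ : LipschitzWith Lφ φ)
    {C : ℝ} (hC : ∀ w, |φ w| ≤ C) :
    ENNReal.ofReal |(∫ w, φ w ∂(P.map fun Z (i : Fin m) => Z (Fin.castLE hM i))) -
        ∫ w, φ w ∂(Q.map fun Z (i : Fin m) => Z (Fin.castLE hN i))| ≤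
      (m : ℝ≥0∞) * ((Lφ : ℝ≥0∞) * bigDistMK1 P Q +
        ((m : ℝ≥0∞) - 1) * ENNReal.ofReal C * ((M : ℝ≥0∞)⁻¹ + (N : ℝ≥0∞)⁻¹)) := by
  have hC0 : 0 ≤ C := (abs_nonneg _).trans (hC 0)
  have hm0 : (0 : ℝ) ≤ (m : ℝ) - 1 := sub_nonneg.2 (by exact_mod_cast hm)
  have hPm := hP.abs_integral_sub_tensorAverage_le (hm.trans hM) hφ.continuous hC
    (Fin.castLE_injective hM)
  have hQm := hQ.abs_integral_sub_tensorAverage_le (hm.trans hN) hφ.continuous hC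
    (Fin.castLE_injective hN)
  rw [integral_map (Measurable.aemeasurable (by fun_prop)) hφ.continuous.aestronglyMeasurable,
    integral_map (Measurable.aemeasurable (by fun_prop)) hφ.continuous.aestronglyMeasurable]
  set a := ∫ Z, φ (fun i => Z (Fin.castLE hM i)) ∂P
  set b := ∫ Z, φ (fun i => Z (Fin.castLE hN i)) ∂Q
  set a' := ∫ Z, tensorAverage φ Z ∂P
  set b' := ∫ Z, tensorAverage φ Z ∂Q
  have hreal : |a - b| ≤ |a' - b'| + m * ((m - 1) * C * ((M : ℝ)⁻¹ + (N : ℝ)⁻¹)) := by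
    have e : a - b = (a' - b') + (a - a') - (b - b') := by ring
    rw [e]
    refine (abs_sub _ _).trans ((add_le_add_left (abs_add_le _ _) _).trans ?_)
    linarith
  have hconst : ENNReal.ofReal (m * ((m - 1) * C * ((M : ℝ)⁻¹ + (N : ℝ)⁻¹))) =
      (m : ℝ≥0∞) * (((m : ℝ≥0∞) - 1) * ENNReal.ofReal C * ((M : ℝ≥0∞)⁻¹ + (N : ℝ≥0∞)⁻¹)) := by
    have inv_eq : ∀ n : ℕ, m ≤ n → ENNReal.ofReal ((n : ℝ)⁻¹) = (n : ℝ≥0∞)⁻¹ := fun n hn => by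
      rw [ENNReal.ofReal_inv_of_pos (by exact_mod_cast hm.trans hn), ENNReal.ofReal_natCast]
    rw [ENNReal.ofReal_mul (by positivity), ENNReal.ofReal_mul (by positivity),
      ENNReal.ofReal_mul hm0, ENNReal.ofReal_add (by positivity) (by positivity), inv_eq M hM,
      inv_eq N hN, ENNReal.ofReal_sub _ zero_le_one, ENNReal.ofReal_natCast, ENNReal.ofReal_one]
  refine (ENNReal.ofReal_le_ofReal hreal).trans ?_
  rw [ENNReal.ofReal_add (abs_nonneg _) (by positivity), hconst,
    mul_add (m : ℝ≥0∞) (Lφ * bigDistMK1 P Q), ← mul_assoc (m : ℝ≥0∞) Lφ,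
    ← Real.enorm_eq_ofReal_abs]
  gcongr
  exact enorm_integral_tensorAverage_sub_le (hm.trans hM) (hm.trans hN) hφ hC

end TensorAverage

theorem IsSymmetricMeasure.map_of_equivariant {d M : ℕ}
    {P : Measure (Fin M → EuclideanSpace ℝ (Fin d))} (hP : IsSymmetricMeasure P)
    {T : (Fin M → EuclideanSpace ℝ (Fin d)) → (Fin M → EuclideanSpace ℝ (Fin d))}
    (hT : Measurable T)
    (h : ∀ (σ : Equiv.Perm (Fin M)) Z, T (fun i => Z (σ i)) = fun i => T Z (σ i)) :
    IsSymmetricMeasure (P.map T) := by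
  intro σ
  have hσ : Measurable fun (z : Fin M → EuclideanSpace ℝ (Fin d)) i => z (σ i) := by fun_prop
  conv_rhs => rw [← hP σ]
  rw [Measure.map_map hσ hT, Measure.map_map hT hσ]
  congr 1
  ext1 Z
  exact (h σ Z).symm

/-- uniform stability of the BBGKY hierarchy: with
`P_M(t) = T_t#P_M^in` and `Q_N(t) = T_t#Q_N^in`,
(a) `Dist_{MK,1}(P_M(t), Q_N(t)) ≤ e^{2L|t|} Dist_{MK,1}(P_M^in, Q_N^in)`, and
(b) for every `1 ≤ m ≤ min(M,N)` and every bounded Lipschitz `φ_m` on `(ℝ^d)^m`,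
`|⟨P_{M:m}(t) − Q_{N:m}(t), φ_m⟩| ≤
  m (e^{2L|t|} Lip(φ_m) Dist_{MK,1}(P_M^in, Q_N^in) + (m−1)‖φ_m‖_∞ (1/M + 1/N))`. -/
theorem stmt17 (d : ℕ) (L : ℝ) (hL : 0 ≤ L)
    (K : EuclideanSpace ℝ (Fin d) × EuclideanSpace ℝ (Fin d) → EuclideanSpace ℝ (Fin d))
    (hK : ContDiff ℝ 1 K)
    (hK1 : ∀ z z' : EuclideanSpace ℝ (Fin d), K (z, z') = - K (z', z))
    (hK2 : (∀ z z' : EuclideanSpace ℝ (Fin d), ‖fderiv ℝ (fun w => K (w, z')) z‖ ≤ L) ∧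
           (∀ z z' : EuclideanSpace ℝ (Fin d), ‖fderiv ℝ (fun w => K (z, w)) z'‖ ≤ L))
    (M N : ℕ) (hM : 1 ≤ M) (hN : 1 ≤ N)
    -- the M-particle and N-particle flows
    (TM : ℝ → (Fin M → EuclideanSpace ℝ (Fin d)) → (Fin M → EuclideanSpace ℝ (Fin d)))
    (TN : ℝ → (Fin N → EuclideanSpace ℝ (Fin d)) → (Fin N → EuclideanSpace ℝ (Fin d)))
    (hTMmeas : ∀ t, Measurable (TM t)) (hTNmeas : ∀ t, Measurable (TN t))
    (hTM0 : ∀ Z, TM 0 Z = Z) (hTN0 : ∀ Z, TN 0 Z = Z)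
    (hTMode : ∀ Z t, HasDerivAt (fun s => TM s Z)
      (fun i => (M : ℝ)⁻¹ • ∑ j : Fin M, K (TM t Z i, TM t Z j)) t)
    (hTNode : ∀ Z t, HasDerivAt (fun s => TN s Z)
      (fun i => (N : ℝ)⁻¹ • ∑ j : Fin N, K (TN t Z i, TN t Z j)) t)
    -- the initial distributions
    (Pin : Measure (Fin M → EuclideanSpace ℝ (Fin d)))
    (Qin : Measure (Fin N → EuclideanSpace ℝ (Fin d)))
    (hPprob : IsProbabilityMeasure Pin) (hQprob : IsProbabilityMeasure Qin)
    (hPsym : IsSymmetricMeasure Pin) (hQsym : IsSymmetricMeasure Qin)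
    (hPmom : (∫⁻ Z, ∑ i : Fin M, (‖Z i‖₊ : ℝ≥0∞) ∂Pin) ≠ ⊤)
    (hQmom : (∫⁻ Z, ∑ i : Fin N, (‖Z i‖₊ : ℝ≥0∞) ∂Qin) ≠ ⊤) :
    -- (a) uniform-in-(M,N) stability estimate
    (∀ t : ℝ,
      bigDistMK1 (Measure.map (TM t) Pin) (Measure.map (TN t) Qin) ≤
        ENNReal.ofReal (Real.exp (2 * L * |t|)) * bigDistMK1 Pin Qin) ∧
    -- (b) comparison of the m-particle marginals
    (∀ t : ℝ, ∀ m : ℕ, 1 ≤ m → ∀ hmM : m ≤ M, ∀ hmN : m ≤ N,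
      ∀ φ : (Fin m → EuclideanSpace ℝ (Fin d)) → ℝ,
      ∀ Lφ : ℝ≥0, LipschitzWith Lφ φ →
      ∀ Cφ : ℝ, (∀ w, |φ w| ≤ Cφ) →
        ENNReal.ofReal
            |(∫ w, φ w ∂(Measure.map (fun Z (i : Fin m) => Z (Fin.castLE hmM i))
                (Measure.map (TM t) Pin))) -
             ∫ w, φ w ∂(Measure.map (fun Z (i : Fin m) => Z (Fin.castLE hmN i))
                (Measure.map (TN t) Qin))| ≤
          (m : ℝ≥0∞) *
            (ENNReal.ofReal (Real.exp (2 * L * |t|)) * (Lφ : ℝ≥0∞) *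
                bigDistMK1 Pin Qin +
              ((m : ℝ≥0∞) - 1) * ENNReal.ofReal Cφ *
                ((M : ℝ≥0∞)⁻¹ + (N : ℝ≥0∞)⁻¹))) := by
  have hKL := norm_sub_le_of_norm_fderiv_le (hK.differentiable one_ne_zero) hK2.1 hK2.2
  have hstab : ∀ t : ℝ, bigDistMK1 (Measure.map (TM t) Pin) (Measure.map (TN t) Qin) ≤
      ENNReal.ofReal (Real.exp (2 * L * |t|)) * bigDistMK1 Pin Qin := fun t => by
    refine bigDistMK1_map_le (hTMmeas t) (hTNmeas t) (by simp [Real.exp_pos])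
      ENNReal.ofReal_ne_top fun X Y => ?_
    have := distMK1_flow_le hM hN hKL (x := fun s => TM s X) (y := fun s => TN s Y)
      (hTMode X) (hTNode Y) t
    simpa only [hTM0, hTN0] using this
  refine ⟨hstab, fun t m hm hmM hmN φ Lφ hφ Cφ hCφ => ?_⟩
  have := Measure.isProbabilityMeasure_map (μ := Pin) (hTMmeas t).aemeasurable
  have := Measure.isProbabilityMeasure_map (μ := Qin) (hTNmeas t).aemeasurable
  refine (ofReal_abs_integral_marginal_sub_le hm hmM hmN
    (hPsym.map_of_equivariant (hTMmeas t) fun σ Z => flow_comp_perm hKL hTM0 hTMode σ Z t)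
    (hQsym.map_of_equivariant (hTNmeas t) fun σ Z => flow_comp_perm hKL hTN0 hTNode σ Z t)
    hφ hCφ).trans ?_
  rw [mul_comm (ENNReal.ofReal (Real.exp _)) (Lφ : ℝ≥0∞), mul_assoc (Lφ : ℝ≥0∞)]
  gcongr
  exact hstab t
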